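/- For any stable 3-pair network N (with fixed paths r_i = P_{s_i,t_1}, g_i = P_{s_i,t_2}), there exist indices i ≠ j in {1,2,3} such that ℓ(r_i) = 1 and ℓ(g_j) = 1. -/

import Mathlib

open scoped BigOperators

/-- A `k`-pair network: a finite DAG with `k` sources of in-degree 0 and
`k` sinks of out-degree 0. -/
structure KPairNetwork (k : ℕ) where
  V : Type
  A : Type
  [fintypeV : Fintype V]
  [fintypeA : Fintype A]
  [decEqV : DecidableEq V]
  [decEqA : DecidableEq A]
  tail : A → V
  head : A → V
  /-- acyclicity, via a topological ordering of the vertices -/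
  acyclic : ∃ ord : V → ℕ, ∀ a : A, ord (tail a) < ord (head a)
  src : Fin k → V
  snk : Fin k → V
  src_inj : Function.Injective src
  snk_inj : Function.Injective snk
  src_no_in : ∀ (i : Fin k) (a : A), head a ≠ src i
  snk_no_out : ∀ (i : Fin k) (a : A), tail a ≠ snk i

attribute [instance] KPairNetwork.fintypeV KPairNetwork.fintypeA
attribute [instance] KPairNetwork.decEqV KPairNetwork.decEqA

namespace KPairNetwork

variable {k : ℕ} (N : KPairNetwork k)

/-- `l` is (the list of arcs of) a directed path from `u` to `v`. -/
def IsPathFrom (u v : N.V) (l : List N.A) : Prop :=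
  l ≠ [] ∧ l.Chain' (fun a b => N.head a = N.tail b) ∧
    (∀ a ∈ l.head?, N.tail a = u) ∧ (∀ a ∈ l.getLast?, N.head a = v)

/-- The vertices lying on a (nonempty) list of arcs. -/
def pathVerts (l : List N.A) : Set N.V :=
  {v | ∃ a ∈ l, v = N.tail a ∨ v = N.head a}

/-- `P i j` is a path from `s i` to `t j`, and for each sink `j` the `k`
paths `P · j` are pairwise arc-disjoint (strong reachability). -/
def IsStrongSystem (P : Fin k → Fin k → List N.A) : Prop :=
  (∀ i j, N.IsPathFrom (N.src i) (N.snk j) (P i j)) ∧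
    ∀ (j i i' : Fin k), i ≠ i' → ∀ a : N.A, a ∈ P i j → a ∉ P i' j

/-- Extra strong reachability: in addition, for each sink `j`, two distinct
paths towards `t j` share no vertex other than `t j`. -/
def IsExtraStrongSystem (P : Fin k → Fin k → List N.A) : Prop :=
  N.IsStrongSystem P ∧
    ∀ (j i i' : Fin k), i ≠ i' →
      ∀ v : N.V, v ∈ N.pathVerts (P i j) → v ∈ N.pathVerts (P i' j) → v = N.snk j

/-- Stability: the choice of the `k` pairwise arc-disjoint paths towards each
sink is unique. -/
def IsStableSystem (P : Fin k → Fin k → List N.A) : Prop :=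
  N.IsStrongSystem P ∧
    ∀ (j : Fin k) (Q : Fin k → List N.A),
      (∀ i, N.IsPathFrom (N.src i) (N.snk j) (Q i)) →
      (∀ i i', i ≠ i' → ∀ a : N.A, a ∈ Q i → a ∉ Q i') →
      ∀ i, Q i = P i j

/-- `excess_f(v) = Σ_{head a = v} f a − Σ_{tail a = v} f a`. -/
noncomputable def excess (f : N.A → ℝ) (v : N.V) : ℝ :=
  (∑ a : N.A, if N.head a = v then f a else 0) -
    (∑ a : N.A, if N.tail a = v then f a else 0)

/-- An `u`–`v` flow: zero excess away from `u` and `v`. -/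
def IsFlow (u v : N.V) (f : N.A → ℝ) : Prop :=
  ∀ w : N.V, w ≠ u → w ≠ v → N.excess f w = 0

/-- The unit flow along a path: `1` on its arcs and `0` elsewhere. -/
noncomputable def unitFlow (l : List N.A) : N.A → ℝ :=
  fun a => if a ∈ l then 1 else 0

/-- The set of source/sink index pairs whose path passes through the arc `a`. -/
def arcPattern (P : Fin k → Fin k → List N.A) (a : N.A) : Finset (Fin k × Fin k) :=
  Finset.univ.filter (fun q => a ∈ P q.1 q.2)

/-- `S_N`, the family of index-pair patterns of the arcs of `N`. -/
def SN (P : Fin k → Fin k → List N.A) : Set (Finset (Fin k × Fin k)) :=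
  {T | ∃ a : N.A, T = N.arcPattern P a}

/-! ### Segments and longest common segments -/

/-- A segment: a start vertex together with a (possibly empty) chained list of
arcs starting there.  A segment with no arcs is a single vertex. -/
def IsSeg (s : N.V × List N.A) : Prop :=
  s.2.Chain' (fun a b => N.head a = N.tail b) ∧ ∀ a ∈ s.2.head?, N.tail a = s.1

/-- The vertices of a segment. -/
def segVerts (s : N.V × List N.A) : Set N.V :=
  insert s.1 (N.pathVerts s.2)

/-- The final vertex of a segment. -/
def segEnd (s : N.V × List N.A) : N.V :=
  s.2.getLast?.elim s.1 N.head

/-- The segment `s` lies on the path `p`. -/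
def SegOn (s : N.V × List N.A) (p : List N.A) : Prop :=
  s.2 <:+: p ∧ s.1 ∈ N.pathVerts p

/-- The segment `s` is contained in the segment `s'`. -/
def SegLE (s s' : N.V × List N.A) : Prop :=
  s.2 <:+: s'.2 ∧ s.1 ∈ N.segVerts s'

/-- `s` is a longest common segment (l.c.s.) of the set of paths `ps`:
it is a segment common to all paths of `ps`, and no segment properly
containing it is common to all paths of `ps`. -/
def IsLCS (ps : Set (List N.A)) (s : N.V × List N.A) : Prop :=
  N.IsSeg s ∧ (∀ p ∈ ps, N.SegOn s p) ∧
    ∀ s' : N.V × List N.A, N.IsSeg s' → N.SegLE s s' → s' ≠ s →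
      ∃ p ∈ ps, ¬ N.SegOn s' p

/-- `s` is an l.c.s. of some pair `{P i j₁, P i' j₂}` and lies on `p`. -/
def IsPairLCSOn (P : Fin k → Fin k → List N.A) (j₁ j₂ : Fin k)
    (p : List N.A) (s : N.V × List N.A) : Prop :=
  (∃ i i' : Fin k, N.IsLCS {P i j₁, P i' j₂} s) ∧ N.SegOn s p

/-- `ℓ^{j₁,j₂}(p)`: the number of l.c.s.'s of pairs `{P i j₁, P i' j₂}` lying
on the path `p`. -/
noncomputable def lcsCount (P : Fin k → Fin k → List N.A) (j₁ j₂ : Fin k)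
    (p : List N.A) : ℕ :=
  Nat.card {s : N.V × List N.A | N.IsPairLCSOn P j₁ j₂ p s}

/-- `m_{j₁,j₂}^c = {i : ℓ^{j₁,j₂}(P_{s_i,t_c}) = 1}`. -/
def mset (P : Fin k → Fin k → List N.A) (j₁ j₂ c : Fin k) : Set (Fin k) :=
  {i | N.lcsCount P j₁ j₂ (P i c) = 1}

/-- `u` lies strictly before `v` along the path `p` (there is a nonempty
infix of `p` going from `u` to `v`). -/
def StrictlyBeforeOn (p : List N.A) (u v : N.V) : Prop :=
  ∃ l : List N.A, l <:+: p ∧ l.head?.map N.tail = some u ∧ l.getLast?.map N.head = some v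

/-- `e 0, …, e (L-1)` enumerates, in the order along `p`, the l.c.s.'s
`p(1) < p(2) < ⋯ < p(L)` of pairs `{P i j₁, P i' j₂}` lying on `p`. -/
def IsLCSEnum (P : Fin k → Fin k → List N.A) (j₁ j₂ : Fin k) (p : List N.A)
    (e : ℕ → N.V × List N.A) (L : ℕ) : Prop :=
  (∀ n, n < L → N.IsPairLCSOn P j₁ j₂ p (e n)) ∧
  (∀ s, N.IsPairLCSOn P j₁ j₂ p s → ∃ n, n < L ∧ e n = s) ∧
  (∀ m n, m < n → n < L → N.StrictlyBeforeOn p (N.segEnd (e m)) (e n).1)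

/-! ### Residual networks, regular cycles, semi-cycles and crossings -/

/-- `a` is a `P_{t_j}`-arc. -/
def isPArc (P : Fin k → Fin k → List N.A) (j : Fin k) (a : N.A) : Prop :=
  ∃ i, a ∈ P i j

/-- The tail of `a` in the `j`-th residual network `N_j` (in which all
`P_{t_j}`-arcs are reversed). -/
def rtail (P : Fin k → Fin k → List N.A) (j : Fin k) (a : N.A) : N.V :=
  if ∃ i, a ∈ P i j then N.head a else N.tail a

/-- The head of `a` in the `j`-th residual network `N_j`. -/
def rhead (P : Fin k → Fin k → List N.A) (j : Fin k) (a : N.A) : N.V :=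
  if ∃ i, a ∈ P i j then N.tail a else N.head a

/-- `l` is a directed cycle of the residual network `N_j`. -/
def IsResidCycle (P : Fin k → Fin k → List N.A) (j : Fin k) (l : List N.A) : Prop :=
  l ≠ [] ∧ l.Nodup ∧
  l.Chain' (fun a b => N.rhead P j a = N.rtail P j b) ∧
  (∀ a ∈ l.getLast?, ∀ b ∈ l.head?, N.rhead P j a = N.rtail P j b) ∧
  (l.map (N.rtail P j)).Nodup

/-- A regular cycle of `N_j`: a directed cycle of `N_j` having no isolated
vertex of `P_{t_j}`, i.e. every vertex of the cycle lying on a path of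
`P_{t_j}` is incident in the cycle to some (reversed) `P_{t_j}`-arc. -/
def IsRegularCycle (P : Fin k → Fin k → List N.A) (j : Fin k) (l : List N.A) : Prop :=
  N.IsResidCycle P j l ∧
    ∀ v ∈ l.map (N.rtail P j),
      (∃ i, v ∈ N.pathVerts (P i j)) →
      ∃ a ∈ l, N.isPArc P j a ∧ (v = N.tail a ∨ v = N.head a)

/-- A `P_{t_j}`-semi-cycle of `N`: the arc set of a regular cycle of `N_j`,
with the original orientations of `N` restored. -/
def IsSemiCycle (P : Fin k → Fin k → List N.A) (j : Fin k) (E : Set N.A) : Prop :=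
  ∃ l : List N.A, N.IsRegularCycle P j l ∧ E = {a | a ∈ l}

/-- A `P_{t_j}`-crossing of `N`: a `P_{t_j}`-semi-cycle with all its
`P_{t_j}`-arcs removed. -/
def IsCrossing (P : Fin k → Fin k → List N.A) (j : Fin k) (E : Set N.A) : Prop :=
  ∃ l : List N.A, N.IsRegularCycle P j l ∧ E = {a | a ∈ l ∧ ¬ N.isPArc P j a}

end KPairNetwork

namespace KPairNetwork

variable {k : ℕ} (N : KPairNetwork k)

/-- `l` is the list of arcs of a possibly empty directed walk from `u` to `w`. -/
def IsWalk (u w : N.V) : List N.A → Prop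
  | [] => u = w
  | a :: l => N.tail a = u ∧ IsWalk (N.head a) w l

variable {N}

theorem IsWalk.append {u v w : N.V} {l m : List N.A} (hl : N.IsWalk u v l)
    (hm : N.IsWalk v w m) : N.IsWalk u w (l ++ m) := by
  induction l generalizing u with
  | nil => cases hl; exact hm
  | cons a l ih => exact ⟨hl.1, ih hl.2⟩

theorem isWalk_append_iff {u w : N.V} {l m : List N.A} :
    N.IsWalk u w (l ++ m) ↔ ∃ v, N.IsWalk u v l ∧ N.IsWalk v w m := by
  refine ⟨fun h => ?_, fun ⟨v, hl, hm⟩ => hl.append hm⟩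
  induction l generalizing u with
  | nil => exact ⟨u, rfl, h⟩
  | cons a l ih =>
    obtain ⟨v, hl, hm⟩ := ih h.2
    exact ⟨v, ⟨h.1, hl⟩, hm⟩

theorem IsWalk.end_unique {u v w : N.V} {l : List N.A} (h : N.IsWalk u v l)
    (h' : N.IsWalk u w l) : v = w := by
  induction l generalizing u with
  | nil => exact h.symm.trans h'
  | cons a l ih => exact ih h.2 h'.right

/-- A nonempty closed walk does not exist. -/
theorem IsWalk.eq_nil {u : N.V} {l : List N.A} (h : N.IsWalk u u l) : l = [] := by
  obtain ⟨ord, hord⟩ := N.acyclic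
  have key : ∀ (l : List N.A) (u w : N.V), N.IsWalk u w l → ord u + l.length ≤ ord w := by
    intro l
    induction l with
    | nil => intro u w h; cases h; simp
    | cons a l ih =>
      intro u w h
      have h1 := ih _ _ h.2
      have h2 := hord a
      rw [h.1] at h2
      simp only [List.length_cons]
      omega
  have := key l u u h
  exact List.length_eq_zero_iff.mp (by omega)

theorem isPathFrom_iff {u w : N.V} {l : List N.A} :
    N.IsPathFrom u w l ↔ l ≠ [] ∧ N.IsWalk u w l := by
  unfold IsPathFrom
  refine and_congr_right fun hl => ?_
  induction l generalizing u with
  | nil => exact absurd rfl hl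
  | cons a l ih =>
    cases l with
    | nil => simp [IsWalk, List.Chain']
    | cons b l =>
      have := ih (u := N.head a) (by simp)
      simp only [IsWalk, List.head?_cons, Option.mem_def, Option.some.injEq, forall_eq',
        List.getLast?_cons_cons, List.Chain', List.isChain_cons_cons] at this ⊢
      rw [← this]
      constructor
      · rintro ⟨⟨h1, h2⟩, h3, h4⟩
        exact ⟨h3, h2, h1.symm, h4⟩
      · rintro ⟨h3, h2, h1, h4⟩
        exact ⟨⟨h1.symm, h2⟩, h3, h4⟩

theorem IsWalk.isChain {u w : N.V} {l : List N.A} (h : N.IsWalk u w l) :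
    l.IsChain (fun a b => N.head a = N.tail b) := by
  by_cases hl : l = []
  · simp [hl]
  · exact (isPathFrom_iff.mpr ⟨hl, h⟩).2.1

theorem IsWalk.tail_head? {u w : N.V} {l : List N.A} (h : N.IsWalk u w l) :
    ∀ a ∈ l.head?, N.tail a = u := by
  by_cases hl : l = []
  · simp [hl]
  · exact (isPathFrom_iff.mpr ⟨hl, h⟩).2.2.1

theorem tail_mem_pathVerts {a : N.A} {l : List N.A} (h : a ∈ l) :
    N.tail a ∈ N.pathVerts l := ⟨a, h, Or.inl rfl⟩

theorem head_mem_pathVerts {a : N.A} {l : List N.A} (h : a ∈ l) :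
    N.head a ∈ N.pathVerts l := ⟨a, h, Or.inr rfl⟩

theorem pathVerts_mono {l m : List N.A} (h : l ⊆ m) : N.pathVerts l ⊆ N.pathVerts m :=
  fun _ ⟨a, ha, hv⟩ => ⟨a, h ha, hv⟩

/-- The end of a walk is its start or the head of one of its arcs. -/
theorem IsWalk.end_eq {u w : N.V} {l : List N.A} (h : N.IsWalk u w l) :
    (l = [] ∧ u = w) ∨ ∃ a ∈ l, N.head a = w := by
  induction l generalizing u with
  | nil => exact Or.inl ⟨rfl, h⟩
  | cons a l ih =>
    rcases ih h.2 with ⟨rfl, h'⟩ | ⟨b, hb, h'⟩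
    · exact Or.inr ⟨a, by simp, h'⟩
    · exact Or.inr ⟨b, by simp [hb], h'⟩

theorem IsWalk.start_mem_pathVerts {u w : N.V} {l : List N.A} (h : N.IsWalk u w l)
    (hl : l ≠ []) : u ∈ N.pathVerts l := by
  cases l with
  | nil => exact absurd rfl hl
  | cons a l => exact h.1 ▸ tail_mem_pathVerts (by simp)

/-- Each vertex of a walk is its start or the head of one of its arcs. -/
theorem IsWalk.eq_start_or_head {u w v : N.V} {l : List N.A} (h : N.IsWalk u w l)
    (hv : v ∈ N.pathVerts l) : v = u ∨ ∃ a ∈ l, N.head a = v := by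
  obtain ⟨a, ha, rfl | rfl⟩ := hv
  · obtain ⟨l₁, l₂, rfl⟩ := List.append_of_mem ha
    obtain ⟨x, h1, h2⟩ := isWalk_append_iff.mp h
    rw [h2.1]
    rcases h1.end_eq with ⟨-, h'⟩ | ⟨b, hb, h'⟩
    · exact Or.inl h'.symm
    · exact Or.inr ⟨b, by simp [hb], h'⟩
  · exact Or.inr ⟨a, ha, rfl⟩

/-- A walk can be split at each of its vertices other than its end, with nonempty second part. -/
theorem IsWalk.split_of_mem {u w v : N.V} {l : List N.A} (h : N.IsWalk u w l)
    (hv : v ∈ N.pathVerts l) (hvw : v ≠ w) :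
    ∃ l₁ l₂, l = l₁ ++ l₂ ∧ l₂ ≠ [] ∧ N.IsWalk u v l₁ ∧ N.IsWalk v w l₂ := by
  obtain ⟨a, ha, rfl | rfl⟩ := hv <;> obtain ⟨l₁, l₂, rfl⟩ := List.append_of_mem ha
  · obtain ⟨x, h1, h2⟩ := isWalk_append_iff.mp h
    exact ⟨l₁, a :: l₂, rfl, by simp, h2.1 ▸ h1, ⟨rfl, h2.2⟩⟩
  · obtain ⟨x, h1, h2⟩ := isWalk_append_iff.mp h
    refine ⟨l₁ ++ [a], l₂, by simp, ?_, h1.append ⟨h2.1, rfl⟩, h2.2⟩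
    rintro rfl
    exact hvw h2.2

/-! ### Stable systems -/

variable {P : Fin k → Fin k → List N.A}

theorem IsStableSystem.ne_nil (hP : N.IsStableSystem P) (i j : Fin k) : P i j ≠ [] :=
  (hP.1.1 i j).1

theorem IsStableSystem.isWalk (hP : N.IsStableSystem P) (i j : Fin k) :
    N.IsWalk (N.src i) (N.snk j) (P i j) :=
  (isPathFrom_iff.mp (hP.1.1 i j)).2

theorem IsStableSystem.src_ne_snk (hP : N.IsStableSystem P) (i j : Fin k) :
    N.src i ≠ N.snk j := by
  intro h
  have := hP.isWalk i j
  rw [h] at this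
  exact hP.ne_nil i j this.eq_nil

theorem IsStableSystem.eq_of_mem (hP : N.IsStableSystem P) {i i' j : Fin k} {a : N.A}
    (h : a ∈ P i j) (h' : a ∈ P i' j) : i = i' := by
  by_contra hne
  exact absurd h' (hP.1.2 j i _ hne a h)

/-- Rerouting the paths towards `t_j` along arcs off these paths cannot give anything new. -/
theorem IsStableSystem.reroute_eq (hP : N.IsStableSystem P) (j : Fin k)
    (σ : Equiv.Perm (Fin k)) (A M B Y : Fin k → List N.A) (x y : Fin k → N.V)
    (hg : ∀ i, P i j = A i ++ M i ++ B i)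
    (hA : ∀ i, N.IsWalk (N.src i) (x i) (A i))
    (hB : ∀ i, N.IsWalk (y i) (N.snk j) (B i))
    (hY : ∀ i, N.IsWalk (x i) (y (σ i)) (Y i))
    (hYP : ∀ i i', ∀ a ∈ Y i, a ∉ P i' j)
    (hYY : ∀ i i' a, a ∈ Y i → a ∈ Y i' → i = i') (i : Fin k) :
    A i ++ Y i ++ B (σ i) = P i j := by
  have hAP : ∀ i, ∀ a ∈ A i, a ∈ P i j := fun i a ha => by simp [hg, ha]
  have hBP : ∀ i, ∀ a ∈ B i, a ∈ P i j := fun i a ha => by simp [hg, ha]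
  have hAB : ∀ i i' a, a ∈ A i → a ∉ B i' := by
    intro i i' a ha hb
    obtain rfl := hP.eq_of_mem (hAP _ _ ha) (hBP _ _ hb)
    have hw := hP.isWalk i j
    obtain ⟨l₁, l₂, h1⟩ := List.append_of_mem ha
    obtain ⟨m₁, m₂, h2⟩ := List.append_of_mem hb
    have e : P i j = l₁ ++ (a :: (l₂ ++ M i ++ m₁) ++ (a :: m₂)) := by simp [hg, h1, h2]
    rw [e] at hw
    obtain ⟨p, -, hw⟩ := isWalk_append_iff.mp hw
    obtain ⟨q, hw1, hw2⟩ := isWalk_append_iff.mp hw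
    have : N.IsWalk q q (a :: (l₂ ++ M i ++ m₁)) := by
      have e := hw1.1
      rw [hw2.1] at e
      subst e
      exact hw1
    simpa using this.eq_nil
  refine hP.2 j (fun i => A i ++ Y i ++ B (σ i)) (fun i => ?_) (fun i i' hne a ha ha' => ?_) i
  · have hw := ((hA i).append (hY i)).append (hB (σ i))
    refine isPathFrom_iff.mpr ⟨fun h => hP.src_ne_snk i j ?_, hw⟩
    rw [h] at hw
    exact hw
  · simp only [List.mem_append] at ha ha'
    rcases ha with (ha | ha) | ha <;> rcases ha' with (ha' | ha') | ha'
    · exact hne (hP.eq_of_mem (hAP _ _ ha) (hAP _ _ ha'))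
    · exact hYP _ _ _ ha' (hAP _ _ ha)
    · exact hAB _ _ _ ha ha'
    · exact hYP _ _ _ ha (hAP _ _ ha')
    · exact hne (hYY _ _ _ ha ha')
    · exact hYP _ _ _ ha (hBP _ _ ha')
    · exact hAB _ _ _ ha' ha
    · exact hYP _ _ _ ha' (hBP _ _ ha)
    · have hab := hP.eq_of_mem (hBP _ _ ha) (hBP _ _ ha')
      exact hne (σ.injective hab)

/-- In a stable network, distinct paths towards the same sink meet only at that sink. -/
theorem IsStableSystem.eq_of_mem_pathVerts (hP : N.IsStableSystem P) {i i' j : Fin k} {v : N.V}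
    (h : v ∈ N.pathVerts (P i j)) (h' : v ∈ N.pathVerts (P i' j)) (hv : v ≠ N.snk j) :
    i = i' := by
  by_contra hne
  obtain ⟨A, B, e, hB0, hA, hB⟩ := (hP.isWalk i j).split_of_mem h hv
  obtain ⟨A', B', e', hB0', hA', hB'⟩ := (hP.isWalk i' j).split_of_mem h' hv
  have key := hP.reroute_eq j (Equiv.swap i i')
    (fun l => if l = i then A else if l = i' then A' else P l j) (fun _ => [])
    (fun l => if l = i then B else if l = i' then B' else []) (fun _ => [])
    (fun l => if l = i then v else if l = i' then v else N.snk j)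
    (fun l => if l = i then v else if l = i' then v else N.snk j)
    (fun l => by split_ifs with h1 h2 <;> simp_all)
    (fun l => by
      split_ifs with h1 h2
      · exact h1 ▸ hA
      · exact h2 ▸ hA'
      · exact hP.isWalk l j)
    (fun l => by
      split_ifs with h1 h2
      · exact hB
      · exact hB'
      · rfl)
    (fun l => by
      by_cases h1 : l = i
      · subst h1; simp [IsWalk]
      · by_cases h2 : l = i'
        · subst h2; simp [IsWalk]
        · simp [IsWalk, Equiv.swap_apply_of_ne_of_ne h1 h2])
    (by simp) (by simp) i
  simp only [Equiv.swap_apply_left, if_true, Ne.symm hne, if_false, List.append_nil] at key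
  obtain ⟨b, hb⟩ := List.exists_mem_of_ne_nil _ hB0'
  exact hne (hP.eq_of_mem (a := b) (by rw [← key]; simp [hb]) (by rw [e']; simp [hb]))

theorem IsStableSystem.ne_snk (hP : N.IsStableSystem P) {i c d : Fin k} (hcd : c ≠ d) {v : N.V}
    (h : v ∈ N.pathVerts (P i d)) : v ≠ N.snk c := by
  rintro rfl
  obtain ⟨l₁, l₂, -, h0, -, hw⟩ :=
    (hP.isWalk i d).split_of_mem h fun h' => hcd (N.snk_inj h')
  cases l₂ with
  | nil => exact h0 rfl
  | cons a l => exact N.snk_no_out _ _ hw.1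

/-- A walk from `s_i` all of whose arcs lie on paths towards `t_d` follows the path
from `s_i` to `t_d`. -/
theorem IsStableSystem.isPrefix (hP : N.IsStableSystem P) (i d : Fin k) (X : List N.A)
    (x : N.V) (hX : N.IsWalk (N.src i) x X) (h : ∀ a ∈ X, ∃ m, a ∈ P m d) : X <+: P i d := by
  induction X using List.reverseRecOn generalizing x with
  | nil => simp
  | append_singleton X a ih =>
    obtain ⟨y, hXy, hya, -⟩ := isWalk_append_iff.mp hX
    obtain ⟨W, hW⟩ := ih y hXy fun b hb => h b (by simp [hb])
    obtain ⟨m, hm⟩ := h a (by simp)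
    have hw := hP.isWalk i d
    rw [← hW] at hw
    obtain ⟨y', hXy', hyW⟩ := isWalk_append_iff.mp hw
    obtain rfl := hXy.end_unique hXy'
    have hy : y ≠ N.snk d := hya ▸ N.snk_no_out d a
    have hW0 : W ≠ [] := by
      rintro rfl
      exact hy hyW
    have hyi : y ∈ N.pathVerts (P i d) :=
      pathVerts_mono (by simp [← hW]) (hyW.start_mem_pathVerts hW0)
    obtain rfl := hP.eq_of_mem_pathVerts hyi (hya ▸ tail_mem_pathVerts hm) hy
    rw [← hW, List.mem_append] at hm
    rcases hm with hm | hm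
    · obtain ⟨l₁, l₂, rfl⟩ := List.append_of_mem hm
      obtain ⟨z, -, hz⟩ := isWalk_append_iff.mp hXy
      have : N.IsWalk y y (a :: l₂) := ⟨hya, hz.2⟩
      simpa using this.eq_nil
    · obtain ⟨l₁, l₂, rfl⟩ := List.append_of_mem hm
      obtain ⟨z, h1, h2⟩ := isWalk_append_iff.mp hyW
      obtain rfl : z = y := h2.1.symm.trans hya
      obtain rfl := h1.eq_nil
      exact ⟨l₂, by simpa using hW⟩

/-! ### Paths leaving the paths towards another sink -/

variable (P) in
/-- After an initial piece shared with `P i d`, the path `P i c` avoids all paths towards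
`t_d`. -/
def IsClean (c d i : Fin k) : Prop :=
  ∃ X R, P i c = X ++ R ∧ X <+: P i d ∧ ∀ a ∈ R, ∀ m, N.head a ∉ N.pathVerts (P m d)

variable (P) in
/-- After an initial piece shared with `P i d`, the path `P i c` continues off the paths
towards `t_d` until it hits `P l d`. -/
def Hits (c d i l : Fin k) : Prop :=
  ∃ (X Y Z : List N.A) (x v : N.V), P i c = X ++ Y ++ Z ∧ X <+: P i d ∧ Y ≠ [] ∧
    (∀ a ∈ Y, ∀ m, a ∉ P m d) ∧ N.IsWalk (N.src i) x X ∧ N.IsWalk x v Y ∧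
    v ∈ N.pathVerts (P l d)

theorem Hits.exists_common {c d i l : Fin k} (h : Hits P c d i l) :
    ∃ v, v ∈ N.pathVerts (P i c) ∧ v ∈ N.pathVerts (P l d) := by
  obtain ⟨X, Y, Z, x, v, e, -, hY0, -, -, hY, hv⟩ := h
  rcases hY.end_eq with ⟨h, -⟩ | ⟨a, ha, rfl⟩
  · exact absurd h hY0
  · exact ⟨_, head_mem_pathVerts (by simp [e, ha]), hv⟩

theorem _root_.List.exists_eq_append_cons_of_exists_mem {α : Type*} {p : α → Prop} {l : List α}
    (h : ∃ a ∈ l, p a) : ∃ l₁ a l₂, l = l₁ ++ a :: l₂ ∧ p a ∧ ∀ b ∈ l₁, ¬ p b := by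
  induction l with
  | nil => simp at h
  | cons b l ih =>
    by_cases hb : p b
    · exact ⟨[], b, l, rfl, hb, by simp⟩
    · obtain ⟨l₁, a, l₂, rfl, ha, hl⟩ := ih (by simpa [hb] using h)
      exact ⟨b :: l₁, a, l₂, rfl, ha, by simpa [hb] using hl⟩

theorem IsStableSystem.isClean_or_hits (hP : N.IsStableSystem P) {c d : Fin k} (hcd : c ≠ d)
    (i : Fin k) : IsClean P c d i ∨ ∃ l, Hits P c d i l := by
  have hw := hP.isWalk i c
  obtain ⟨X, b, R, e, hb, hX⟩ :
      ∃ X b R, P i c = X ++ b :: R ∧ (¬ ∃ m, b ∈ P m d) ∧ ∀ a ∈ X, ¬ ¬ ∃ m, a ∈ P m d := by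
    apply List.exists_eq_append_cons_of_exists_mem
    rcases hw.end_eq with ⟨h, -⟩ | ⟨a, ha, h⟩
    · exact absurd h (hP.ne_nil i c)
    · exact ⟨a, ha, fun ⟨m, hm⟩ => hP.ne_snk hcd (head_mem_pathVerts hm) h⟩
  simp only [not_not] at hX
  rw [e] at hw
  obtain ⟨x, hwX, hwR⟩ := isWalk_append_iff.mp hw
  have hpre := hP.isPrefix i d X x hwX hX
  by_cases hclean : ∃ a ∈ b :: R, ∃ m, N.head a ∈ N.pathVerts (P m d)
  · right
    obtain ⟨Y, a, Z, e', ⟨l, hl⟩, hY⟩ := List.exists_eq_append_cons_of_exists_mem hclean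
    have e'' : b :: R = (Y ++ [a]) ++ Z := by simp [e']
    rw [e''] at hwR
    obtain ⟨v, hwY, hwZ⟩ := isWalk_append_iff.mp hwR
    obtain rfl : N.head a = v := by
      obtain ⟨y, -, hy⟩ := isWalk_append_iff.mp hwY
      exact hy.2
    refine ⟨l, X, Y ++ [a], Z, x, N.head a, by rw [e, e'']; simp, hpre, by simp, ?_, hwX, hwY, hl⟩
    intro a' ha' m hm
    obtain ⟨Y₁, Y₂, hYe⟩ := List.append_of_mem ha'
    rw [hYe] at hwY
    obtain ⟨y, hy1, hy2⟩ := isWalk_append_iff.mp hwY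
    rcases hy1.end_eq with ⟨rfl, -⟩ | ⟨b', hb', rfl⟩
    · rw [hYe] at e''
      simp only [List.nil_append, List.cons_append, List.cons.injEq] at e''
      exact hb ⟨m, e''.1 ▸ hm⟩
    · refine hY b' ?_ ⟨m, hy2.1 ▸ tail_mem_pathVerts hm⟩
      have : Y = (Y₁ ++ a' :: Y₂).dropLast := by rw [← hYe]; simp
      rw [this, List.dropLast_append_of_ne_nil (by simp)]
      simp [hb']
  · left
    push Not at hclean
    exact ⟨X, b :: R, e, hpre, hclean⟩

theorem _root_.Finset.exists_perm_of_mapsTo {α : Type*} [Finite α] {f : α → α}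
    {B : Finset α} (hB : B.Nonempty) (hf : ∀ i ∈ B, f i ∈ B) :
    ∃ C ⊆ B, C.Nonempty ∧ ∃ σ : Equiv.Perm α,
      (∀ i ∈ C, σ i = f i) ∧ ∀ i ∉ C, σ i = i := by
  classical
  obtain ⟨C, ⟨hCB, hC, hfC⟩, hmin⟩ :=
    (Set.toFinite {C : Finset α | C ⊆ B ∧ C.Nonempty ∧ ∀ i ∈ C, f i ∈ C}).exists_minimal
      ⟨B, subset_rfl, hB, hf⟩
  have himg : C.image f = C := by
    have hsub : C.image f ⊆ C := Finset.image_subset_iff.mpr hfC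
    refine subset_antisymm hsub (hmin ⟨hsub.trans hCB, hC.image f, ?_⟩ hsub)
    intro i hi
    exact Finset.mem_image_of_mem f (hsub hi)
  have hsurj : Function.Surjective fun i => if i ∈ C then f i else i := by
    intro i
    by_cases hi : i ∈ C
    · rw [← himg] at hi
      obtain ⟨l, hl, rfl⟩ := Finset.mem_image.mp hi
      exact ⟨l, by simp [hl]⟩
    · exact ⟨i, by simp [hi]⟩
  refine ⟨C, hCB, hC, Equiv.ofBijective _ (Finite.surjective_iff_bijective.mp hsurj), ?_, ?_⟩ <;>
  · intro i hi
    simp [hi]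

theorem IsStableSystem.exists_not_hits (hP : N.IsStableSystem P) {c d : Fin k} (hcd : c ≠ d)
    {S : Finset (Fin k)} (hS : S.Nonempty) : ∃ i ∈ S, ∀ l ∈ S, ¬ Hits P c d i l := by
  by_contra! hcon
  choose! f hfS hf using hcon
  obtain ⟨C, hCS, hC, σ, hσC, hσ⟩ := Finset.exists_perm_of_mapsTo hS hfS
  have hf' : ∀ i ∈ C, Hits P c d i (σ i) := fun i hi => hσC i hi ▸ hf i (hCS hi)
  have : Nonempty N.V := ⟨N.src hS.choose⟩
  choose! X Y Z x v e hpre hY0 hYP hX hY hv using hf'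
  have hvr : ∀ i ∈ C, v i ∈ N.pathVerts (P i c) := by
    intro i hi
    rcases (hY i hi).end_eq with ⟨h, -⟩ | ⟨a, ha, h⟩
    · exact absurd h (hY0 i hi)
    · exact h ▸ head_mem_pathVerts (by simp [e i hi, ha])
  have hσmem : ∀ i ∈ C, σ i ∈ C := by
    intro i hi
    by_contra h
    rw [σ.injective (hσ _ h)] at h
    exact h hi
  have split : ∀ i ∈ C, ∃ M B, P (σ i) d = X (σ i) ++ M ++ B ∧ N.IsWalk (v i) (N.snk d) B := by
    intro i hi
    obtain ⟨l₁, l₂, e₁, -, hw₁, hw₂⟩ := (hP.isWalk (σ i) d).split_of_mem (hv i hi)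
      (hP.ne_snk hcd.symm (hvr i hi))
    obtain ⟨W, hW⟩ := hpre (σ i) (hσmem i hi)
    rw [← hW, List.append_eq_append_iff] at e₁
    rcases e₁ with ⟨M, h1, h2⟩ | ⟨M, h1, h2⟩
    · exact ⟨M, l₂, by simp [← hW, h2], hw₂⟩
    · by_cases hM : M = []
      · subst hM
        exact ⟨[], l₂, by simp [← hW, h2], hw₂⟩
      exfalso
      have hXw := hX (σ i) (hσmem i hi)
      rw [h1] at hXw
      obtain ⟨z, hz1, hz2⟩ := isWalk_append_iff.mp hXw
      obtain rfl := hw₁.end_unique hz1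
      have hvσ : v i ∈ N.pathVerts (P (σ i) c) :=
        pathVerts_mono (by simp [e (σ i) (hσmem i hi), h1])
          (hz2.start_mem_pathVerts hM)
      have hσi : i = σ i :=
        hP.eq_of_mem_pathVerts (hvr i hi) hvσ (hP.ne_snk hcd (hv i hi))
      rw [← hσi] at hz2
      have := (hz2.append (hY i hi)).eq_nil
      simp [hM] at this
  choose! M B hMB hB using split
  have key := hP.reroute_eq d σ
    (fun i => if i ∈ C then X i else P i d) (fun i => if i ∈ C then M (σ.symm i) else [])
    (fun i => if i ∈ C then B (σ.symm i) else []) (fun i => if i ∈ C then Y i else [])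
    (fun i => if i ∈ C then x i else N.snk d)
    (fun i => if i ∈ C then v (σ.symm i) else N.snk d)
  have hsymm : ∀ i ∈ C, σ.symm i ∈ C := by
    intro i hi
    by_contra h
    have := hσ _ h
    rw [Equiv.apply_symm_apply] at this
    exact h (this ▸ hi)
  obtain ⟨i, hi⟩ := hC
  have key' := key
    (fun i => by
      by_cases hi : i ∈ C
      · simpa [hi] using hMB (σ.symm i) (hsymm i hi)
      · simp [hi])
    (fun i => by
      by_cases hi : i ∈ C
      · simpa [hi] using hX i hi
      · simpa [hi] using hP.isWalk i d)
    (fun i => by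
      by_cases hi : i ∈ C
      · simpa [hi] using hB (σ.symm i) (hsymm i hi)
      · simp [hi, IsWalk])
    (fun i => by
      by_cases hi : i ∈ C
      · simpa [hi, hσmem i hi] using hY i hi
      · simp [hi, hσ i hi, IsWalk])
    (fun i i' a ha => by
      by_cases hi : i ∈ C
      · exact hYP i hi a (by simpa [hi] using ha) i'
      · simp [hi] at ha)
    (fun i i' a ha ha' => by
      by_cases hi : i ∈ C
      · by_cases hi' : i' ∈ C
        · simp only [hi, hi', if_true] at ha ha'
          exact hP.eq_of_mem (j := c) (a := a) (by simp [e i hi, ha]) (by simp [e i' hi', ha'])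
        · simp [hi'] at ha'
      · simp [hi] at ha) i
  obtain ⟨b, hb⟩ := List.exists_mem_of_ne_nil _ (hY0 i hi)
  exact hYP i hi b hb i (by rw [← key']; simp [hi, hb])

/-! ### Counting longest common segments -/

theorem IsClean.mem_of_mem (hP : N.IsStableSystem P) {c d i m : Fin k} {X R : List N.A}
    (e : P i c = X ++ R) (hR : ∀ a ∈ R, ∀ m, N.head a ∉ N.pathVerts (P m d)) {v : N.V}
    (hv : v ∈ N.pathVerts (P i c)) (hv' : v ∈ N.pathVerts (P m d)) :
    v ∈ N.segVerts (N.src i, X) := by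
  rcases (hP.isWalk i c).eq_start_or_head hv with rfl | ⟨a, ha, rfl⟩
  · exact Or.inl rfl
  · rw [e, List.mem_append] at ha
    rcases ha with ha | ha
    · exact Or.inr (head_mem_pathVerts ha)
    · exact absurd hv' (hR a ha m)

theorem IsStableSystem.segVerts_subset (hP : N.IsStableSystem P) {i d : Fin k} {X : List N.A}
    (hX : X <+: P i d) : N.segVerts (N.src i, X) ⊆ N.pathVerts (P i d) := by
  rintro v (rfl | hv)
  · exact (hP.isWalk i d).start_mem_pathVerts (hP.ne_nil i d)
  · exact pathVerts_mono hX.subset hv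

theorem IsClean.not_mem (hP : N.IsStableSystem P) {c d i l : Fin k} (hcd : c ≠ d)
    (h : IsClean P c d i) (hli : l ≠ i) {v : N.V} (hv : v ∈ N.pathVerts (P i c)) :
    v ∉ N.pathVerts (P l d) := by
  intro hv'
  obtain ⟨X, R, e, hX, hR⟩ := h
  exact hli (hP.eq_of_mem_pathVerts hv' (hP.segVerts_subset hX (mem_of_mem hP e hR hv hv'))
    (hP.ne_snk hcd.symm hv))

/-- A segment through a source starts at that source. -/
theorem IsSeg.eq_src_of_mem {s : N.V × List N.A} (hs : N.IsSeg s) {i : Fin k}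
    (h : N.src i ∈ N.segVerts s) : s.1 = N.src i := by
  rcases h with h | ⟨a, ha, h | h⟩
  · exact h.symm
  · obtain ⟨l₁, l₂, hl⟩ := List.append_of_mem ha
    rcases List.eq_nil_or_concat l₁ with rfl | ⟨l, b, rfl⟩
    · exact (hs.2 a (by simp [hl])).symm.trans h.symm
    · have hc : s.2.IsChain (fun a b => N.head a = N.tail b) := hs.1
      rw [hl, List.isChain_append] at hc
      have := hc.2.2 b (by simp) a (by simp)
      exact absurd (this.trans h.symm) (N.src_no_in i b)
  · exact absurd h.symm (N.src_no_in i a)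

theorem IsSeg.isPrefix_of_isInfix {i : Fin k} {w : N.V} {l p : List N.A}
    (hs : N.IsSeg (N.src i, l)) (hp : N.IsWalk (N.src i) w p) (h : l <:+: p) : l <+: p := by
  cases l with
  | nil => simp
  | cons a l =>
    obtain ⟨s, t, rfl⟩ := h
    obtain ⟨y, h1, -⟩ := isWalk_append_iff.mp hp
    obtain ⟨z, h1, h2⟩ := isWalk_append_iff.mp h1
    have h3 := hs.2 a (by simp)
    have : z = N.src i := h2.1.symm.trans h3
    subst this
    obtain rfl := h1.eq_nil
    exact ⟨t, by simp⟩

theorem _root_.List.IsInfix.isInfix_left_of_disjoint {α : Type*} {l X R : List α}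
    (h : l <:+: X ++ R) (hR : ∀ a ∈ l, a ∉ R) : l <:+: X := by
  obtain ⟨s, t, h⟩ := h
  rcases List.eq_nil_or_concat l with rfl | ⟨l', b, rfl⟩
  · exact List.nil_infix
  rcases List.append_eq_append_iff.mp h with ⟨M, h1, h2⟩ | ⟨M, h1, h2⟩
  · exact ⟨s, M, h1.symm⟩
  · rcases List.eq_nil_or_concat M with rfl | ⟨M', b', rfl⟩
    · exact ⟨s, [], by simpa using h1⟩
    · refine absurd ?_ (hR b (by simp))
      rw [List.concat_eq_append, List.concat_eq_append, ← List.append_assoc,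
        ← List.append_assoc] at h1
      have := (List.append_inj' h1 rfl).2
      simp only [List.cons.injEq, and_true] at this
      simp [h2, this]

theorem IsClean.lcsCount_eq_one (hP : N.IsStableSystem P) {c d i : Fin k} (hcd : c ≠ d)
    (h : IsClean P c d i) : N.lcsCount P c d (P i c) = 1 := by
  obtain ⟨X, R, e, hX, hR⟩ := h
  have hwc := hP.isWalk i c
  have hsrc : ∀ j, N.src i ∈ N.pathVerts (P i j) := fun j =>
    (hP.isWalk i j).start_mem_pathVerts (hP.ne_nil i j)
  have hon : ∀ p ∈ ({P i c, P i d} : Set (List N.A)), N.SegOn (N.src i, X) p := by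
    rintro p (rfl | rfl)
    · exact ⟨⟨[], R, by simp [e]⟩, hsrc c⟩
    · exact ⟨hX.isInfix, hsrc d⟩
  have hseg : N.IsSeg (N.src i, X) := by
    rw [e] at hwc
    obtain ⟨x, hx, -⟩ := isWalk_append_iff.mp hwc
    exact ⟨hx.isChain, hx.tail_head?⟩
  have hlcs : N.IsLCS {P i c, P i d} (N.src i, X) := by
    refine ⟨hseg, hon, ?_⟩
    rintro ⟨u, l⟩ hs' hle hne
    by_contra! hcon
    obtain rfl : u = N.src i := hs'.eq_src_of_mem hle.2
    have hpre : l <+: X ++ R := e ▸ hs'.isPrefix_of_isInfix hwc (hcon _ (by simp)).1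
    have hld : l <:+: P i d := (hcon _ (by simp)).1
    have hXl : X <+: l :=
      List.prefix_of_prefix_length_le ⟨R, rfl⟩ hpre (List.IsInfix.length_le hle.1)
    obtain ⟨L, rfl⟩ := hXl
    cases L with
    | nil => simp at hne
    | cons a L =>
      have haR : a ∈ R := ((List.prefix_append_right_inj X).mp hpre).subset (by simp)
      exact hR a haR i (head_mem_pathVerts (hld.subset (by simp)))
  have huniq : {s | N.IsPairLCSOn P c d (P i c) s} = {(N.src i, X)} := by
    ext s
    simp only [Set.mem_ofPred_eq, Set.mem_singleton_iff]
    refine ⟨?_, ?_⟩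
    · rintro ⟨⟨a, b, hs, hson, hmax⟩, hsi⟩
      have hsa := hson (P a c) (by simp)
      have hsb := hson (P b d) (by simp)
      obtain rfl : i = a := hP.eq_of_mem_pathVerts hsi.2 hsa.2 (hP.ne_snk hcd hsb.2)
      have hmem : s.1 ∈ N.segVerts (N.src i, X) := mem_of_mem hP e hR hsi.2 hsb.2
      obtain rfl : i = b := hP.eq_of_mem_pathVerts (hP.segVerts_subset hX hmem) hsb.2
        (hP.ne_snk hcd.symm hsi.2)
      by_contra hne
      have hinf : s.2 <:+: X := by
        refine List.IsInfix.isInfix_left_of_disjoint (R := R) (e ▸ hsi.1) fun a ha haR => ?_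
        exact hR a haR i (head_mem_pathVerts (hsb.1.subset ha))
      obtain ⟨p, hp, hnot⟩ := hmax (N.src i, X) hseg ⟨hinf, hmem⟩ (Ne.symm hne)
      exact hnot (hon p hp)
    · rintro rfl
      exact ⟨⟨i, i, hlcs⟩, hon _ (by simp)⟩
  rw [lcsCount, huniq]
  simp

theorem lcsCount_comm (P : Fin k → Fin k → List N.A) (c d : Fin k) (p : List N.A) :
    N.lcsCount P c d p = N.lcsCount P d c p := by
  unfold lcsCount IsPairLCSOn
  congr! 4 with s
  rw [exists_comm]
  simp only [Set.pair_comm]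

end KPairNetwork

/-- Lemma 4 of the paper: in a stable 3-pair network there
are indices `i ≠ j` with `ℓ(r_i) = 1` and `ℓ(g_j) = 1`, where `r i = P i t₁`
and `g j = P j t₂`. -/
theorem statement4 (N : KPairNetwork 3) (P : Fin 3 → Fin 3 → List N.A)
    (hP : N.IsStableSystem P) :
    ∃ i j : Fin 3, i ≠ j ∧
      N.lcsCount P 0 1 (P i 0) = 1 ∧ N.lcsCount P 0 1 (P j 1) = 1 := by
  have h01 : (0 : Fin 3) ≠ 1 := by decide
  have clean : ∀ c d : Fin 3, c ≠ d → ∀ S : Finset (Fin 3), S.Nonempty →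
      (∀ i ∈ S, ∀ l, KPairNetwork.Hits P c d i l → l ∈ S) →
      ∃ i ∈ S, KPairNetwork.IsClean P c d i := by
    intro c d hcd S hS hclosed
    obtain ⟨i, hi, hno⟩ := hP.exists_not_hits hcd hS
    refine ⟨i, hi, (hP.isClean_or_hits hcd i).resolve_right ?_⟩
    rintro ⟨l, hl⟩
    exact hno l (hclosed i hi l hl) hl
  obtain ⟨j, -, hj⟩ := clean 1 0 h01.symm Finset.univ Finset.univ_nonempty (by simp)
  have hS : (Finset.univ.erase j).Nonempty := by
    rw [← Finset.card_pos, Finset.card_erase_of_mem (Finset.mem_univ j)]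
    simp
  obtain ⟨i, hi, hi'⟩ := clean 0 1 h01 _ hS (by
    intro i hi l hl
    refine Finset.mem_erase.mpr ⟨?_, Finset.mem_univ l⟩
    rintro rfl
    obtain ⟨v, hv, hv'⟩ := hl.exists_common
    exact hj.not_mem hP h01.symm (Finset.ne_of_mem_erase hi) hv' hv)
  exact ⟨i, j, Finset.ne_of_mem_erase hi, hi'.lcsCount_eq_one hP h01,
    (KPairNetwork.lcsCount_comm P 0 1 _).trans (hj.lcsCount_eq_one hP h01.symm)⟩
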